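/- Assume the Generalized Riemann Hypothesis for all Dirichlet L-functions. Then for every real number ε with 0 < ε < 1/8, there exist infinitely many prime numbers p such that there are positive integers m and n with m² dividing p + 2, n² dividing p − 2, m > p^ε and n > p^ε. -/

import Mathlib

/-- The Generalized Riemann Hypothesis for all Dirichlet L-functions: for every positive
modulus `q`, every Dirichlet character `χ` mod `q` and every `s` in the critical strip,
if `L(s, χ) = 0` then `Re s = 1/2`. -/
def GRH : Prop :=
  ∀ (q : ℕ) [NeZero q] (χ : DirichletCharacter ℂ q) (s : ℂ),
    0 < s.re → s.re < 1 → DirichletCharacter.LFunction χ s = 0 → s.re = 1 / 2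

open Metric

theorem norm_iteratedDeriv_logDeriv_le {g : ℂ → ℂ} {c : ℂ} {R r B : ℝ} (k : ℕ)
    (hr : 0 < r) (hrR : r < R) (hB : 1 < B) (hg : DifferentiableOn ℂ g (ball c R))
    (hg0 : ∀ z ∈ ball c R, g z ≠ 0) (hgB : ∀ z ∈ ball c R, ‖g z‖ ≤ B * ‖g c‖) :
    ‖iteratedDeriv k (logDeriv g) c‖ ≤
      (k + 1).factorial * (2 * Real.log B * r / (R - r)) / r ^ (k + 1) := by
  have hR : 0 < R := hr.trans hrR
  have hc : c ∈ ball c R := mem_ball_self hR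
  have hderiv : DifferentiableOn ℂ (deriv g) (ball c R) := hg.deriv isOpen_ball
  have hlog : DifferentiableOn ℂ (logDeriv g) (ball c R) := hderiv.div hg hg0
  obtain ⟨h, hhc, hh⟩ := hlog.isExactOn_ball.with_val_at c 0
  have hexp : ∀ z ∈ ball c R, g z = g c * Complex.exp (h z) := by
    intro z hz
    have key : Set.EqOn (fun w => g w * Complex.exp (-h w)) (fun _ => g c) (ball c R) := by
      refine isOpen_ball.eqOn_of_deriv_eq (convex_ball c R).isPreconnected ?_ (by fun_prop) ?_ hc
        (by simp [hhc])
      · intro w hw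
        exact ((hg w hw).differentiableAt (isOpen_ball.mem_nhds hw) |>.mul
          ((hh w hw).differentiableAt.neg.cexp)).differentiableWithinAt
      · intro w hw
        have h1 := ((hg w hw).differentiableAt (isOpen_ball.mem_nhds hw)).hasDerivAt.mul
          (hh w hw).neg.cexp
        have h2 := h1.deriv
        simp only [deriv_const]
        refine h2.trans ?_
        rw [logDeriv_apply]
        field_simp [hg0 w hw]
        ring
    have := key hz
    simp only [Complex.exp_neg] at this
    rw [← this]
    field_simp
  have hre : ∀ z ∈ ball c R, (h z).re ≤ Real.log B := by
    intro z hz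
    have h1 := hgB z hz
    rw [hexp z hz, norm_mul, Complex.norm_exp, mul_comm] at h1
    have h2 := le_of_mul_le_mul_right h1 (norm_pos_iff.2 (hg0 c hc))
    exact (Real.le_log_iff_exp_le (by linarith)).2 h2
  have hhd : DifferentiableOn ℂ h (ball c R) := fun z hz =>
    (hh z hz).differentiableAt.differentiableWithinAt
  have hbound : ∀ z ∈ sphere c r, ‖h z‖ ≤ 2 * Real.log B * r / (R - r) := by
    intro z hz
    have hzn : ‖z - c‖ = r := mem_sphere_iff_norm.1 hz
    have hmaps : Set.MapsTo (fun w : ℂ => w + c) (ball 0 R) (ball c R) := by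
      intro w hw
      simpa [dist_eq_norm] using hw
    have := Complex.borelCaratheodory_zero (f := fun w => h (w + c)) (z := z - c)
      (Real.log_pos hB) (hhd.comp (by fun_prop) hmaps) (fun w hw => hre _ (hmaps hw)) hR
      (by simpa [hzn] using hrR) (by simpa using hhc)
    simpa [hzn] using this
  have hcl : DiffContOnCl ℂ h (ball c r) :=
    (hhd.mono (by rw [closure_ball _ hr.ne']; exact closedBall_subset_ball hrR)).diffContOnCl
  have hev : deriv h =ᶠ[nhds c] logDeriv g := by
    filter_upwards [isOpen_ball.mem_nhds hc] with z hz using (hh z hz).deriv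
  rw [← hev.iteratedDeriv_eq, ← iteratedDeriv_succ']
  exact Complex.norm_iteratedDeriv_le_of_forall_mem_sphere_norm_le (k + 1) hr hcl hbound

theorem norm_natCast_cpow_neg_sub_le {s : ℂ} (hs : 1 / 2 < s.re) (n : ℕ) :
    ‖((n + 2 : ℕ) : ℂ) ^ (-s) - ((n + 1 : ℕ) : ℂ) ^ (-s)‖ ≤
      ‖s‖ * ((n + 1 : ℕ) : ℝ) ^ (-(3 / 2) : ℝ) := by
  have h := norm_image_sub_le_of_norm_deriv_le_segment' (f := fun t : ℝ => (t : ℂ) ^ (-s))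
    (f' := fun t : ℝ => -s * (t : ℂ) ^ (-s - 1)) (a := (n + 1 : ℕ)) (b := (n + 2 : ℕ))
    (C := ‖s‖ * ((n + 1 : ℕ) : ℝ) ^ (-(3 / 2) : ℝ)) ?_ ?_ (n + 2 : ℕ) ?_
  · refine (le_of_eq_of_le ?_ h).trans (le_of_eq ?_)
    · simp
    · push_cast; ring
  · intro t ht
    have ht0 : (0 : ℝ) < t := lt_of_lt_of_le (by positivity) ht.1
    have h1 : HasDerivAt (fun z : ℂ => z ^ (-s)) (-s * (t : ℂ) ^ (-s - 1)) (t : ℂ) := by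
      simpa using (hasDerivAt_id (t : ℂ)).cpow_const (c := -s) (Or.inl (by simpa using ht0))
    exact h1.comp_ofReal.hasDerivWithinAt
  · intro t ht
    have h1 : (1 : ℝ) ≤ ((n + 1 : ℕ) : ℝ) := by push_cast; linarith [n.cast_nonneg (α := ℝ)]
    have ht0 : (0 : ℝ) < t := lt_of_lt_of_le (by positivity) ht.1
    rw [norm_mul, norm_neg, Complex.norm_cpow_eq_rpow_re_of_pos ht0]
    refine mul_le_mul_of_nonneg_left ?_ (norm_nonneg _)
    calc t ^ (-s - 1).re ≤ t ^ (-(3 / 2) : ℝ) :=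
          Real.rpow_le_rpow_of_exponent_le (h1.trans ht.1) (by simp; linarith)
      _ ≤ _ := Real.rpow_le_rpow_of_nonpos (by positivity) ht.1 (by norm_num)
  · constructor <;> push_cast <;> linarith

theorem DirichletCharacter.norm_sum_range_succ_le {q : ℕ} [NeZero q] {χ : DirichletCharacter ℂ q}
    (hχ : χ ≠ 1) (n : ℕ) : ‖∑ i ∈ Finset.range n, χ ((i + 1 : ℕ) : ZMod q)‖ ≤ q := by
  have hq : 0 < q := NeZero.pos q
  have hperiod : ∑ i ∈ Finset.range q, χ ((i + 1 : ℕ) : ZMod q) = 0 := by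
    rw [← MulChar.sum_eq_zero_of_ne_one hχ]
    refine Finset.sum_nbij' (fun i => ((i + 1 : ℕ) : ZMod q)) (fun a => (a - 1).val) ?_ ?_ ?_ ?_ ?_
    · simp
    · intro a _; simpa using ZMod.val_lt _
    · intro i hi
      simp [ZMod.val_natCast, Nat.mod_eq_of_lt (Finset.mem_range.1 hi)]
    · intro a _; simp
    · simp
  have hmod (m : ℕ) : ∑ i ∈ Finset.range (q + m), χ ((i + 1 : ℕ) : ZMod q) =
      ∑ i ∈ Finset.range m, χ ((i + 1 : ℕ) : ZMod q) := by
    rw [Finset.sum_range_add, hperiod, zero_add]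
    simp
  induction n using Nat.strong_induction_on with
  | _ n ih =>
    rcases lt_or_ge n q with h | h
    · refine (norm_sum_le _ _).trans ((Finset.sum_le_sum fun i _ => χ.norm_le_one _).trans ?_)
      simpa using h.le
    · obtain ⟨m, rfl⟩ := Nat.exists_eq_add_of_le h
      rw [hmod]
      exact ih m (by omega)

theorem DirichletCharacter.norm_LFunction_le {q : ℕ} [NeZero q] {χ : DirichletCharacter ℂ q}
    (hχ : χ ≠ 1) {s : ℂ} (hs : 1 / 2 < s.re) :
    ‖LFunction χ s‖ ≤ q * ‖s‖ * ∑' n : ℕ, ((n + 1 : ℕ) : ℝ) ^ (-(3 / 2) : ℝ) := by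
  set U : Set ℂ := {s | 1 / 2 < s.re} with hU
  have hUo : IsOpen U := isOpen_lt continuous_const Complex.continuous_re
  have hUc : IsPreconnected U := (convex_halfSpace_re_gt (1 / 2)).isPreconnected
  have hU0 : ∀ z ∈ U, z ≠ 0 := by
    rintro z hz rfl
    simp only [hU, Set.mem_ofPred_eq, Complex.zero_re] at hz
    linarith
  set G : ℕ → ℂ := fun n => ∑ i ∈ Finset.range n, χ ((i + 1 : ℕ) : ZMod q) with hG
  set F : ℕ → ℂ → ℂ := fun n z =>
    ((((n + 2 : ℕ) : ℂ) ^ (-z) - ((n + 1 : ℕ) : ℂ) ^ (-z)) * G (n + 1)) / z with hF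
  set u : ℕ → ℝ := fun n => q * ((n + 1 : ℕ) : ℝ) ^ (-(3 / 2) : ℝ) with hu
  have hsum0 : Summable fun n : ℕ => ((n + 1 : ℕ) : ℝ) ^ (-(3 / 2) : ℝ) :=
    (summable_nat_add_iff 1).2 (Real.summable_nat_rpow.2 (by norm_num))
  have husum : Summable u := hsum0.mul_left _
  have hFu : ∀ n, ∀ z ∈ U, ‖F n z‖ ≤ u n := by
    intro n z hz
    have hz0 : 0 < ‖z‖ := norm_pos_iff.2 (hU0 z hz)
    rw [hF, hu]
    simp only [norm_div, norm_mul]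
    rw [div_le_iff₀ hz0]
    calc _ ≤ (‖z‖ * ((n + 1 : ℕ) : ℝ) ^ (-(3 / 2) : ℝ)) * q :=
          mul_le_mul (norm_natCast_cpow_neg_sub_le hz n) (norm_sum_range_succ_le hχ _)
            (norm_nonneg _) (by positivity)
      _ = _ := by ring
  have hFd : ∀ n, DifferentiableOn ℂ (F n) U := by
    intro n z hz
    have h1 : ((n + 2 : ℕ) : ℂ) ≠ 0 := Nat.cast_ne_zero.2 (by omega)
    have h2 : ((n + 1 : ℕ) : ℂ) ≠ 0 := Nat.cast_ne_zero.2 (by omega)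
    refine DifferentiableAt.differentiableWithinAt ?_
    refine DifferentiableAt.div (((DifferentiableAt.const_cpow (by fun_prop) (Or.inl h1)).sub
      (DifferentiableAt.const_cpow (by fun_prop) (Or.inl h2))).mul_const _) (by fun_prop)
      (hU0 z hz)
  have hseries : ∀ z : ℂ, 1 < z.re → LFunction χ z / z = -∑' n, F n z := by
    intro z hz
    have hzU : z ∈ U := by
      simp only [hU, Set.mem_ofPred_eq]; linarith
    have hL : HasSum (fun n => LSeries.term (fun n => χ n) z n) (LFunction χ z) := by
      rw [LFunction_eq_LSeries χ hz]
      exact (LSeriesSummable_of_one_lt_re χ hz).hasSum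
    have hL1 : HasSum (fun n : ℕ => ((n + 1 : ℕ) : ℂ) ^ (-z) * χ ((n + 1 : ℕ) : ZMod q))
        (LFunction χ z) := by
      have := (hasSum_nat_add_iff' 1).2 hL
      simp only [Finset.range_one, Finset.sum_singleton, LSeries.term_zero, sub_zero] at this
      refine this.congr_fun ?_
      intro n
      rw [LSeries.term_of_ne_zero (Nat.succ_ne_zero n), Complex.cpow_neg]
      ring
    have ht1 := hL1.tendsto_sum_nat
    have hT : HasSum (fun n => F n z) (∑' n, F n z) :=
      (Summable.of_norm_bounded husum (fun n => hFu n z hzU)).hasSum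
    have ht2 := hT.tendsto_sum_nat
    have ht3 : Filter.Tendsto (fun N : ℕ => ((N + 1 : ℕ) : ℂ) ^ (-z) * G (N + 1))
        Filter.atTop (nhds 0) := by
      have : Filter.Tendsto (fun N : ℕ => ((N + 1 : ℕ) : ℝ) ^ (-z.re) * q)
          Filter.atTop (nhds 0) := by
        have h0 := (tendsto_rpow_neg_atTop (y := z.re) (by linarith)).comp
          (tendsto_natCast_atTop_atTop (R := ℝ))
        have := ((Filter.tendsto_add_atTop_iff_nat 1).2 h0).mul_const (q : ℝ)
        simpa using this
      refine squeeze_zero_norm (fun N => ?_) this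
      rw [norm_mul, Complex.norm_natCast_cpow_of_pos (Nat.succ_pos N)]
      exact mul_le_mul_of_nonneg_left (norm_sum_range_succ_le hχ _) (by positivity)
    have hparts : ∀ N : ℕ, ∑ n ∈ Finset.range (N + 1),
        ((n + 1 : ℕ) : ℂ) ^ (-z) * χ ((n + 1 : ℕ) : ZMod q) =
        ((N + 1 : ℕ) : ℂ) ^ (-z) * G (N + 1) - z * ∑ n ∈ Finset.range N, F n z := by
      intro N
      have := Finset.sum_range_by_parts (fun n : ℕ => ((n + 1 : ℕ) : ℂ) ^ (-z))
        (fun n : ℕ => χ ((n + 1 : ℕ) : ZMod q)) (N + 1)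
      simp only [smul_eq_mul, Nat.add_sub_cancel] at this
      rw [this]
      congr 1
      rw [Finset.mul_sum]
      refine Finset.sum_congr rfl fun n _ => ?_
      simp only [hF]
      field_simp [hU0 z hzU]
      rfl
    have ht4 := (ht3.sub (ht2.const_mul z))
    have ht5 := (Filter.tendsto_add_atTop_iff_nat 1).2 ht1
    simp only [hparts] at ht5
    have := tendsto_nhds_unique ht5 ht4
    rw [this]
    field_simp [hU0 z hzU]
    ring
  have hFan : DifferentiableOn ℂ (fun z => -∑' n, F n z) U :=
    (Complex.differentiableOn_tsum_of_summable_norm husum hFd hUo hFu).neg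
  have hLan : DifferentiableOn ℂ (fun z => LFunction χ z / z) U := fun z hz =>
    (((differentiable_LFunction hχ) z).div differentiableAt_id (hU0 z hz)).differentiableWithinAt
  have heq : Set.EqOn (fun z => LFunction χ z / z) (fun z => -∑' n, F n z) U := by
    refine (hLan.analyticOnNhd hUo).eqOn_of_preconnected_of_eventuallyEq
      (hFan.analyticOnNhd hUo) hUc (z₀ := 2) (by simp [hU]; norm_num) ?_
    filter_upwards [(isOpen_lt continuous_const Complex.continuous_re).mem_nhds
      (show (1 : ℝ) < (2 : ℂ).re by norm_num)] with z hz using hseries z hz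
  have hs0 := hU0 s hs
  have h1 := heq hs
  simp only at h1
  rw [div_eq_iff hs0] at h1
  rw [h1, norm_mul, norm_neg]
  have h2 : ‖∑' n, F n s‖ ≤ ∑' n, u n := tsum_of_norm_bounded husum.hasSum fun n => hFu n s hs
  rw [hu, tsum_mul_left] at h2
  calc _ ≤ _ := mul_le_mul_of_nonneg_right h2 (norm_nonneg s)
    _ = _ := by ring

namespace DirichletCharacter

open scoped Classical in
/-- The `L`-function of `χ`, multiplied by `s - 1` when `χ` is trivial: an entire function. -/
noncomputable def entireLFunction {q : ℕ} [NeZero q] (χ : DirichletCharacter ℂ q) : ℂ → ℂ :=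
  if χ = 1 then LFunctionTrivChar₁ q else LFunction χ

variable {q : ℕ} [NeZero q]

theorem entireLFunction_one : entireLFunction (1 : DirichletCharacter ℂ q) =
    LFunctionTrivChar₁ q := if_pos rfl

theorem entireLFunction_of_ne_one {χ : DirichletCharacter ℂ q} (hχ : χ ≠ 1) :
    entireLFunction χ = LFunction χ := if_neg hχ

theorem differentiable_entireLFunction (χ : DirichletCharacter ℂ q) :
    Differentiable ℂ (entireLFunction χ) := by
  by_cases hχ : χ = 1
  · rw [hχ, entireLFunction_one]
    exact differentiable_LFunctionTrivChar₁ q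
  · rw [entireLFunction_of_ne_one hχ]
    exact differentiable_LFunction hχ

theorem LFunction_ne_zero_of_GRH (hGRH : GRH) (χ : DirichletCharacter ℂ q) {s : ℂ}
    (hs : 1 / 2 < s.re) (h : χ ≠ 1 ∨ s ≠ 1) : LFunction χ s ≠ 0 := by
  intro h0
  rcases lt_or_ge s.re 1 with h1 | h1
  · linarith [hGRH q χ s (by linarith) h1 h0]
  · exact LFunction_ne_zero_of_one_le_re χ h h1 h0

theorem entireLFunction_ne_zero_of_GRH (hGRH : GRH) (χ : DirichletCharacter ℂ q) {s : ℂ}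
    (hs : 1 / 2 < s.re) : entireLFunction χ s ≠ 0 := by
  by_cases hχ : χ = 1
  · rw [hχ, entireLFunction_one]
    rcases eq_or_ne s 1 with rfl | h1
    · exact LFunctionTrivChar₁_apply_one_ne_zero q
    · rw [LFunctionTrivChar₁, Function.update_of_ne h1]
      exact mul_ne_zero (sub_ne_zero.2 h1) (LFunction_ne_zero_of_GRH hGRH 1 hs (Or.inr h1))
  · rw [entireLFunction_of_ne_one hχ]
    exact LFunction_ne_zero_of_GRH hGRH χ hs (Or.inl hχ)

open scoped Classical in
theorem neg_logDeriv_LFunction_eq (χ : DirichletCharacter ℂ q) {s : ℂ} (hs : 1 < s.re) :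
    -(deriv (LFunction χ) s / LFunction χ s) =
      (if χ = 1 then (s - 1)⁻¹ else 0) - logDeriv (entireLFunction χ) s := by
  have hs1 : s ≠ 1 := by rintro rfl; simp at hs
  have hs1' : s - 1 ≠ 0 := sub_ne_zero.2 hs1
  by_cases hχ : χ = 1
  · have hL : LFunctionTrivChar q s ≠ 0 :=
      LFunction_ne_zero_of_one_le_re 1 (Or.inr hs1) hs.le
    rw [hχ, if_pos rfl, entireLFunction_one, logDeriv_apply,
      deriv_LFunctionTrivChar₁_apply_of_ne_one q hs1, LFunctionTrivChar₁,
      Function.update_of_ne hs1]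
    field_simp
    ring
  · rw [if_neg hχ, entireLFunction_of_ne_one hχ, logDeriv_apply, zero_sub]

theorem one_le_tsum_mul_norm_LFunction (χ : DirichletCharacter ℂ q) {σ : ℝ} (hσ : 2 ≤ σ) :
    1 ≤ (∑' n : ℕ, (n : ℝ) ^ (-2 : ℝ)) * ‖LFunction χ σ‖ := by
  have hre : 1 < (σ : ℂ).re := by simp; linarith
  have h := LSeries.mul_mu_eq_one χ hre
  rw [← LFunction_eq_LSeries χ hre] at h
  have h2 : ‖LSeries ((fun n : ℕ => χ n) * fun n => (ArithmeticFunction.moebius n : ℂ)) σ‖ ≤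
      ∑' n : ℕ, (n : ℝ) ^ (-2 : ℝ) := by
    refine tsum_of_norm_bounded (Real.summable_nat_rpow.2 (by norm_num)).hasSum fun n => ?_
    rcases eq_or_ne n 0 with rfl | hn
    · simp
    · have hn1 : (1 : ℝ) ≤ n := by exact_mod_cast Nat.one_le_iff_ne_zero.2 hn
      rw [LSeries.term_of_ne_zero hn, norm_div, Complex.norm_natCast_cpow_of_pos
        (Nat.pos_of_ne_zero hn), Pi.mul_apply, norm_mul, Complex.ofReal_re]
      have h3 : ‖(ArithmeticFunction.moebius n : ℂ)‖ ≤ 1 := by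
        rw [Complex.norm_intCast]
        exact_mod_cast ArithmeticFunction.abs_moebius_le_one
      calc _ ≤ 1 * 1 / (n : ℝ) ^ σ := by
            gcongr
            exact χ.norm_le_one _
        _ = (n : ℝ) ^ (-σ) := by rw [Real.rpow_neg (by positivity)]; simp
        _ ≤ _ := Real.rpow_le_rpow_of_exponent_le hn1 (by linarith)
  calc (1 : ℝ) = ‖LSeries ((fun n : ℕ => χ n) * fun n => (ArithmeticFunction.moebius n : ℂ)) σ‖ *
        ‖LFunction χ σ‖ := by rw [← norm_mul, mul_comm, h, norm_one]
    _ ≤ _ := mul_le_mul_of_nonneg_right h2 (norm_nonneg _)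

theorem one_le_tsum_mul_norm_entireLFunction (χ : DirichletCharacter ℂ q) {σ : ℝ} (hσ : 2 ≤ σ) :
    1 ≤ (∑' n : ℕ, (n : ℝ) ^ (-2 : ℝ)) * ‖entireLFunction χ σ‖ := by
  have h := one_le_tsum_mul_norm_LFunction χ hσ
  by_cases hχ : χ = 1
  · have h1 : (σ : ℂ) ≠ 1 := by
      intro h1
      have : σ = 1 := by exact_mod_cast h1
      linarith
    rw [hχ, entireLFunction_one, LFunctionTrivChar₁, Function.update_of_ne h1, norm_mul]
    rw [hχ] at h
    have h2 : (1 : ℝ) ≤ ‖(σ : ℂ) - 1‖ := by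
      rw [← Complex.ofReal_one, ← Complex.ofReal_sub, Complex.norm_real]
      exact (by linarith : (1 : ℝ) ≤ σ - 1).trans (Real.le_norm_self _)
    refine h.trans (mul_le_mul_of_nonneg_left ?_ (tsum_nonneg fun n => by positivity))
    exact le_mul_of_one_le_left (norm_nonneg _) h2
  · rwa [entireLFunction_of_ne_one hχ]

theorem LFunctionTrivChar₁_eq_prod_mul (s : ℂ) : LFunctionTrivChar₁ q s =
    (∏ p ∈ q.primeFactors, (1 - (p : ℂ) ^ (-s))) * LFunctionTrivChar₁ 1 s := by
  rcases eq_or_ne s 1 with rfl | h1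
  · simp [LFunctionTrivChar₁, Complex.cpow_neg]
  · simp only [LFunctionTrivChar₁, Function.update_of_ne h1,
      LFunctionTrivChar_eq_mul_riemannZeta h1]
    simp
    ring

theorem norm_prod_one_sub_cpow_le {s : ℂ} (hs : 0 ≤ s.re) :
    ‖∏ p ∈ q.primeFactors, (1 - (p : ℂ) ^ (-s))‖ ≤ q := by
  have h1 : ‖∏ p ∈ q.primeFactors, (1 - (p : ℂ) ^ (-s))‖ ≤ ∏ p ∈ q.primeFactors, (p : ℝ) := by
    rw [norm_prod]
    refine Finset.prod_le_prod (fun _ _ => norm_nonneg _) fun p hp => ?_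
    have hp' := Nat.prime_of_mem_primeFactors hp
    have h2 : ‖(p : ℂ) ^ (-s)‖ ≤ 1 := by
      rw [Complex.norm_natCast_cpow_of_pos hp'.pos]
      exact Real.rpow_le_one_of_one_le_of_nonpos (by exact_mod_cast hp'.one_le) (by simpa using hs)
    calc _ ≤ ‖(1 : ℂ)‖ + ‖(p : ℂ) ^ (-s)‖ := norm_sub_le _ _
      _ ≤ 2 := by rw [norm_one]; linarith
      _ ≤ p := by exact_mod_cast hp'.two_le
  refine h1.trans ?_
  rw [← Nat.cast_prod]
  exact_mod_cast Nat.le_of_dvd (NeZero.pos q) (Nat.prod_primeFactors_dvd q)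

end DirichletCharacter

theorem half_lt_re_of_mem_ball {A : ℝ} {z : ℂ} (hz : z ∈ ball ((A + 1 : ℝ) : ℂ) (A + 1 / 2)) :
    1 / 2 < z.re := by
  rw [mem_ball, dist_eq_norm] at hz
  have h := (Complex.abs_re_le_norm _).trans_lt hz
  rw [Complex.sub_re, Complex.ofReal_re, abs_lt] at h
  linarith [h.1]

theorem DirichletCharacter.exists_norm_entireLFunction_le {A : ℝ} (hA : 1 ≤ A) :
    ∃ C : ℝ, 1 < C ∧ ∀ (q : ℕ) [NeZero q] (χ : DirichletCharacter ℂ q),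
      ∀ z ∈ ball ((A + 1 : ℝ) : ℂ) (A + 1 / 2),
        ‖entireLFunction χ z‖ ≤ C * q * ‖entireLFunction χ ((A + 1 : ℝ) : ℂ)‖ := by
  obtain ⟨D, hD⟩ := (isCompact_closedBall ((A + 1 : ℝ) : ℂ) (A + 1 / 2)).exists_bound_of_continuousOn
    (differentiable_LFunctionTrivChar₁ 1).continuous.continuousOn
  set Z := ∑' n : ℕ, (n : ℝ) ^ (-2 : ℝ)
  set Y := ∑' n : ℕ, ((n + 1 : ℕ) : ℝ) ^ (-(3 / 2) : ℝ)
  have hZ : 0 ≤ Z := tsum_nonneg fun n => by positivity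
  have hY : 0 ≤ Y := tsum_nonneg fun n => by positivity
  set M := |D| + (2 * A + 2) * Y
  have hM : 0 ≤ M := by positivity
  refine ⟨M * Z + 2, by nlinarith [mul_nonneg hM hZ], fun q _ χ z hz => ?_⟩
  have hzre := half_lt_re_of_mem_ball hz
  have hlow := one_le_tsum_mul_norm_entireLFunction χ (show 2 ≤ A + 1 by linarith)
  have hq0 : (0 : ℝ) ≤ q := q.cast_nonneg
  have hup : ‖entireLFunction χ z‖ ≤ M * q := by
    by_cases hχ : χ = 1
    · rw [hχ, entireLFunction_one, LFunctionTrivChar₁_eq_prod_mul, norm_mul]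
      calc _ ≤ q * |D| := mul_le_mul (norm_prod_one_sub_cpow_le (by linarith))
            ((hD z (ball_subset_closedBall hz)).trans (le_abs_self D)) (norm_nonneg _) hq0
        _ ≤ q * M := by gcongr; exact le_add_of_nonneg_right (by positivity)
        _ = _ := mul_comm _ _
    · rw [entireLFunction_of_ne_one hχ]
      have hzn : ‖z‖ ≤ 2 * A + 2 := by
        rw [mem_ball, dist_eq_norm] at hz
        have h1 : ‖((A + 1 : ℝ) : ℂ)‖ = A + 1 := by
          rw [Complex.norm_real, Real.norm_of_nonneg (by linarith)]
        have := norm_le_norm_add_norm_sub' z ((A + 1 : ℝ) : ℂ)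
        linarith
      calc _ ≤ q * ‖z‖ * Y := norm_LFunction_le hχ hzre
        _ ≤ q * (2 * A + 2) * Y := by gcongr
        _ = ((2 * A + 2) * Y) * q := by ring
        _ ≤ M * q := by gcongr; exact le_add_of_nonneg_left (abs_nonneg D)
  calc _ ≤ M * q * 1 := by rw [mul_one]; exact hup
    _ ≤ M * q * (Z * ‖entireLFunction χ ((A + 1 : ℝ) : ℂ)‖) := by gcongr
    _ = (M * Z) * q * ‖entireLFunction χ ((A + 1 : ℝ) : ℂ)‖ := by ring
    _ ≤ _ := by gcongr; linarith

theorem DirichletCharacter.exists_norm_iteratedDeriv_logDeriv_le (hGRH : GRH) {A r : ℝ}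
    (hA : 1 ≤ A) (hr : 1 ≤ r) (hrA : r < A + 1 / 2) :
    ∃ C D : ℝ, 1 < C ∧ 0 ≤ D ∧ ∀ (q : ℕ) [NeZero q] (χ : DirichletCharacter ℂ q) (k : ℕ),
      ‖iteratedDeriv k (logDeriv (entireLFunction χ)) ((A + 1 : ℝ) : ℂ)‖ ≤
        k.factorial * (D * (k + 1) * Real.log (C * q)) / r ^ k := by
  obtain ⟨C, hC, h⟩ := exists_norm_entireLFunction_le hA
  refine ⟨C, 2 * r / (A + 1 / 2 - r), hC, ?_, fun q _ χ k => ?_⟩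
  · exact div_nonneg (by linarith) (by linarith)
  have hq : (1 : ℝ) ≤ q := by exact_mod_cast NeZero.pos q
  have hCq : 1 < C * q := by nlinarith
  have h1 := norm_iteratedDeriv_logDeriv_le k (by linarith) hrA hCq
    (differentiable_entireLFunction χ).differentiableOn
    (fun z hz => entireLFunction_ne_zero_of_GRH hGRH χ (half_lt_re_of_mem_ball hz)) (h q χ)
  refine h1.trans ?_
  have hlog : 0 ≤ Real.log (C * q) := (Real.log_pos hCq).le
  have hd : 0 < A + 1 / 2 - r := by linarith
  rw [show ((k + 1).factorial : ℝ) * (2 * Real.log (C * q) * r / (A + 1 / 2 - r)) =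
    k.factorial * (2 * r / (A + 1 / 2 - r) * (k + 1) * Real.log (C * q)) by
      rw [Nat.factorial_succ]; push_cast; ring]
  have hr0 : 0 < r := by linarith
  gcongr
  · omega

theorem LSeries.logMul_iterate_apply (f : ℕ → ℂ) (k n : ℕ) :
    (LSeries.logMul^[k] f) n = Complex.log n ^ k * f n := by
  induction k with
  | zero => simp
  | succ k ih =>
    rw [Function.iterate_succ_apply', LSeries.logMul, ih]
    ring

theorem Real.log_pow_mul_rpow_neg_le (k n : ℕ) {B : ℝ} (hB : 0 < B) :
    Real.log n ^ k * (n : ℝ) ^ (-B) ≤ k.factorial / B ^ k := by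
  rcases Nat.eq_zero_or_pos n with rfl | hn
  · rw [Nat.cast_zero, Real.zero_rpow (by linarith), mul_zero]
    positivity
  · have hn' : (0 : ℝ) < n := by exact_mod_cast hn
    have hl : 0 ≤ Real.log n := Real.log_natCast_nonneg n
    have h := Real.pow_div_factorial_le_exp (B * Real.log n) (by positivity) k
    rw [Real.rpow_neg hn'.le, Real.rpow_def_of_pos hn', mul_comm (Real.log n) B]
    rw [div_le_iff₀ (by positivity), mul_pow] at h
    rw [← div_eq_mul_inv, div_le_div_iff₀ (by positivity) (by positivity)]
    linarith

namespace ArithmeticFunction.vonMangoldt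

theorem hasSum_residueClass_mul_log_pow {q : ℕ} (a : ZMod q) (k : ℕ) {σ : ℝ} (hσ : 1 < σ) :
    HasSum (fun n : ℕ => ((residueClass a n * (Real.log n ^ k * (n : ℝ) ^ (-σ)) : ℝ) : ℂ))
      ((-1) ^ k * iteratedDeriv k (LSeries fun n => (residueClass a n : ℂ)) σ) := by
  have habs : LSeries.abscissaOfAbsConv (fun n => (residueClass a n : ℂ)) < (σ : ℂ).re := by
    refine (abscissaOfAbsConv_residueClass_le_one a).trans_lt ?_
    exact_mod_cast hσ
  rw [LSeries_iteratedDeriv k habs, ← mul_assoc, ← mul_pow]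
  simp only [mul_neg, mul_one, neg_neg, one_pow, one_mul]
  have hs : LSeriesSummable (LSeries.logMul^[k] fun n => (residueClass a n : ℂ)) σ :=
    LSeriesSummable_of_abscissaOfAbsConv_lt_re (by rwa [LSeries.absicssaOfAbsConv_logPowMul])
  refine hs.hasSum.congr_fun fun n => ?_
  rcases eq_or_ne n 0 with rfl | hn
  · simp
  · rw [LSeries.term_of_ne_zero hn, LSeries.logMul_iterate_apply, ← Complex.natCast_log]
    push_cast
    rw [Complex.ofReal_cpow n.cast_nonneg, Complex.ofReal_neg, Complex.ofReal_natCast,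
      Complex.cpow_neg]
    ring

theorem summable_residueClass_mul_log_pow {q : ℕ} (a : ZMod q) (k : ℕ) {σ : ℝ} (hσ : 1 < σ) :
    Summable fun n : ℕ => residueClass a n * (Real.log n ^ k * (n : ℝ) ^ (-σ)) :=
  Complex.summable_ofReal.1 (hasSum_residueClass_mul_log_pow a k hσ).summable

open DirichletCharacter

variable {q : ℕ} [NeZero q] {a : ZMod q}

theorem iteratedDeriv_LSeries_residueClass (hGRH : GRH) (ha : IsUnit a) (k : ℕ) {A : ℝ}
    (hA : 0 < A) :
    iteratedDeriv k (LSeries fun n => (residueClass a n : ℂ)) ((A + 1 : ℝ) : ℂ) =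
      (q.totient : ℂ)⁻¹ * ((-1) ^ k * k.factorial * ((A : ℂ) ^ (k + 1))⁻¹ -
        ∑ χ : DirichletCharacter ℂ q,
          χ a⁻¹ * iteratedDeriv k (logDeriv (entireLFunction χ)) ((A + 1 : ℝ) : ℂ)) := by
  classical
  have hev : (LSeries fun n => (residueClass a n : ℂ)) =ᶠ[nhds ((A + 1 : ℝ) : ℂ)]
      fun s => (q.totient : ℂ)⁻¹ * ((fun z => (z - 1)⁻¹) - fun z =>
        ∑ χ : DirichletCharacter ℂ q, χ a⁻¹ * logDeriv (entireLFunction χ) z : ℂ → ℂ) s := by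
    filter_upwards [(isOpen_lt continuous_const Complex.continuous_re).mem_nhds
      (show (1 : ℝ) < ((A + 1 : ℝ) : ℂ).re by simpa using hA)] with s hs
    rw [LSeries_residueClass_eq ha hs, neg_mul, ← mul_neg, ← Finset.sum_neg_distrib]
    congr 1
    have h1 : ∀ χ : DirichletCharacter ℂ q,
        -(χ a⁻¹ * (deriv (LFunction χ) s / LFunction χ s)) =
        (if χ = 1 then (s - 1)⁻¹ else 0) - χ a⁻¹ * logDeriv (entireLFunction χ) s := by
      intro χ
      rw [← mul_neg, neg_logDeriv_LFunction_eq χ hs, mul_sub]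
      congr 1
      split_ifs with hχ
      · have hinv : IsUnit a⁻¹ := by
          obtain ⟨u, rfl⟩ := ha
          rw [ZMod.inv_coe_unit]
          exact Units.isUnit _
        rw [hχ, MulChar.one_apply hinv, one_mul]
      · rw [mul_zero]
    rw [Finset.sum_congr rfl fun χ _ => h1 χ, Finset.sum_sub_distrib]
    simp
  have hA0 : ((A + 1 : ℝ) : ℂ) - 1 ≠ 0 := by
    push_cast
    simpa using hA.ne'
  have hE (χ : DirichletCharacter ℂ q) :
      ContDiffAt ℂ k (logDeriv (entireLFunction χ)) ((A + 1 : ℝ) : ℂ) := by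
    have hd : AnalyticAt ℂ (entireLFunction χ) ((A + 1 : ℝ) : ℂ) :=
      (differentiable_entireLFunction χ).analyticAt _
    refine (hd.deriv.div hd ?_).contDiffAt
    exact entireLFunction_ne_zero_of_GRH hGRH χ (by simp; linarith)
  have hE' (χ : DirichletCharacter ℂ q) : ContDiffAt ℂ k
      (fun s => χ a⁻¹ * logDeriv (entireLFunction χ) s) ((A + 1 : ℝ) : ℂ) :=
    contDiffAt_const.mul (hE χ)
  rw [hev.iteratedDeriv_eq, iteratedDeriv_const_mul_field, iteratedDeriv_sub,
    iteratedDeriv_fun_sum fun χ _ => hE' χ, iteratedDeriv_comp_sub_const (f := fun z : ℂ => z⁻¹)]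
  · congr 2
    · have := iter_deriv_inv k (((A + 1 : ℝ) : ℂ) - 1)
      rw [iteratedDeriv_eq_iterate]
      refine this.trans ?_
      rw [show ((A + 1 : ℝ) : ℂ) - 1 = A by push_cast; ring,
        show (-1 - k : ℤ) = -((k + 1 : ℕ) : ℤ) by push_cast; ring, zpow_neg, zpow_natCast]
    · exact Finset.sum_congr rfl fun χ _ => iteratedDeriv_const_mul_field _ _
  · exact (contDiffAt_id.sub contDiffAt_const).inv hA0
  · exact ContDiffAt.sum fun χ _ => hE' χ

theorem factorial_div_pow_le (hGRH : GRH) (ha : IsUnit a) (k : ℕ) {A E : ℝ} (hA : 0 < A)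
    (hE : ∀ χ : DirichletCharacter ℂ q,
      ‖iteratedDeriv k (logDeriv (entireLFunction χ)) ((A + 1 : ℝ) : ℂ)‖ ≤ E) :
    k.factorial / A ^ (k + 1) ≤
      q * (∑' n : ℕ, residueClass a n * (Real.log n ^ k * (n : ℝ) ^ (-(A + 1))) + E) := by
  set S := ∑' n : ℕ, residueClass a n * (Real.log n ^ k * (n : ℝ) ^ (-(A + 1))) with hS
  have hE0 : 0 ≤ E := (norm_nonneg _).trans (hE 1)
  have hS0 : 0 ≤ S := tsum_nonneg fun n => mul_nonneg (residueClass_nonneg a n)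
    (mul_nonneg (pow_nonneg (Real.log_natCast_nonneg n) k) (by positivity))
  have hφ : (0 : ℝ) < q.totient := by exact_mod_cast Nat.totient_pos.2 (NeZero.pos q)
  have hφ' : (q.totient : ℂ) ≠ 0 := by exact_mod_cast hφ.ne'
  have h1 : (S : ℂ) = (-1) ^ k *
      iteratedDeriv k (LSeries fun n => (residueClass a n : ℂ)) ((A + 1 : ℝ) : ℂ) := by
    rw [hS, Complex.ofReal_tsum]
    exact (hasSum_residueClass_mul_log_pow a k (by linarith)).tsum_eq
  rw [iteratedDeriv_LSeries_residueClass hGRH ha k hA] at h1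
  set T := ∑ χ : DirichletCharacter ℂ q,
    χ a⁻¹ * iteratedDeriv k (logDeriv (entireLFunction χ)) ((A + 1 : ℝ) : ℂ) with hT
  have hTn : ‖T‖ ≤ q.totient * E := by
    calc ‖T‖ ≤ ∑ _χ : DirichletCharacter ℂ q, E := by
          refine (norm_sum_le _ _).trans (Finset.sum_le_sum fun χ _ => ?_)
          rw [norm_mul]
          calc _ ≤ 1 * E := mul_le_mul (χ.norm_le_one _) (hE χ) (norm_nonneg _) zero_le_one
            _ = E := one_mul E
      _ = q.totient * E := by
          rw [Finset.sum_const, nsmul_eq_mul, Finset.card_univ, ← Nat.card_eq_fintype_card,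
            card_eq_totient_of_hasEnoughRootsOfUnity]
  have hsq : ((-1 : ℂ) ^ k) * (-1) ^ k = 1 := by rw [← mul_pow]; simp
  have h2 : ((k.factorial / A ^ (k + 1) : ℝ) : ℂ) = q.totient * S + (-1) ^ k * T := by
    rw [h1]
    push_cast
    have hinv := mul_inv_cancel₀ hφ'
    set X := (-1 : ℂ) ^ k * k.factorial * ((A : ℂ) ^ (k + 1))⁻¹ - T with hX
    linear_combination (-(k.factorial : ℂ) * ((A : ℂ) ^ (k + 1))⁻¹) * hsq -
      (-1) ^ k * X * hinv - (-1) ^ k * hX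
  have h3 : k.factorial / A ^ (k + 1) ≤ q.totient * S + q.totient * E := by
    calc k.factorial / A ^ (k + 1) = ‖((k.factorial / A ^ (k + 1) : ℝ) : ℂ)‖ := by
          rw [Complex.norm_real, Real.norm_of_nonneg (by positivity)]
      _ ≤ ‖(q.totient : ℂ) * S‖ + ‖(-1) ^ k * T‖ := by rw [h2]; exact norm_add_le _ _
      _ ≤ _ := by
          refine add_le_add (le_of_eq ?_) ?_
          · rw [norm_mul, Complex.norm_real, Real.norm_of_nonneg hS0, Complex.norm_natCast]
          · simpa using hTn
  rw [← mul_add] at h3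
  refine h3.trans (mul_le_mul_of_nonneg_right ?_ (add_nonneg hS0 hE0))
  exact_mod_cast Nat.totient_le q

theorem summable_nonprime {α : ℝ} (hα : 1 / 2 < α) :
    Summable fun n : ℕ => (if n.Prime then 0 else vonMangoldt n) * (n : ℝ) ^ (-α) := by
  set s : Set ℕ := {n | IsPrimePow n ∧ ¬ n.Prime} with hs
  have hex : ∀ n : s, ∃ x : ℕ × ℕ, x.1.Prime ∧ x.1 ^ (x.2 + 2) = (n : ℕ) := by
    rintro ⟨n, hn, hn'⟩
    obtain ⟨p, k, hp, hk, rfl⟩ := (isPrimePow_nat_iff n).1 hn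
    have hk2 : 2 ≤ k := by
      by_contra hlt
      obtain rfl : k = 1 := by omega
      exact hn' (by simpa using hp)
    exact ⟨(p, k - 2), hp, by simp [Nat.sub_add_cancel hk2]⟩
  choose i hi using hex
  have hinj : Function.Injective i := fun m n hmn =>
    Subtype.ext ((hi m).2.symm.trans (hmn ▸ (hi n).2))
  have hlog : Summable fun p : ℕ => Real.log p * (p : ℝ) ^ (-(2 * α)) := by
    set δ := (2 * α - 1) / 2 with hδ
    have hδ0 : 0 < δ := by rw [hδ]; linarith
    refine Summable.of_nonneg_of_le (fun p => mul_nonneg (Real.log_natCast_nonneg p) (by positivity))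
      (fun p => ?_) ((Real.summable_nat_rpow.2
        (show δ - 2 * α < -1 by rw [hδ]; linarith)).mul_left δ⁻¹)
    rcases Nat.eq_zero_or_pos p with rfl | hp
    · simp
      positivity
    · have hp' : (0 : ℝ) < p := by exact_mod_cast hp
      rw [sub_eq_add_neg, Real.rpow_add hp', ← mul_assoc]
      refine mul_le_mul_of_nonneg_right ?_ (by positivity)
      rw [inv_mul_eq_div]
      exact Real.log_le_rpow_div hp'.le hδ0
  have hgeo : Summable fun j : ℕ => ((2 : ℝ) ^ (-α)) ^ j :=
    summable_geometric_of_lt_one (by positivity)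
      (Real.rpow_lt_one_of_one_lt_of_neg one_lt_two (by linarith))
  have hprod := (hlog.mul_of_nonneg hgeo
    (fun p => mul_nonneg (Real.log_natCast_nonneg p) (by positivity))
    (fun j => by positivity)).comp_injective hinj
  rw [← (Subtype.val_injective (p := fun n => n ∈ s)).summable_iff]
  · refine Summable.of_nonneg_of_le (fun n => mul_nonneg ?_ (by positivity)) (fun n => ?_) hprod
    · split_ifs
      exacts [le_rfl, vonMangoldt_nonneg]
    · obtain ⟨hp, hn⟩ := hi n
      have hp0 : (0 : ℝ) < (i n).1 := by exact_mod_cast hp.pos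
      have hp2 : (2 : ℝ) ≤ (i n).1 := by exact_mod_cast hp.two_le
      simp only [Function.comp_apply]
      rw [if_neg n.2.2, ← hn, vonMangoldt_apply_pow (Nat.succ_ne_zero _), vonMangoldt_apply_prime hp,
        mul_assoc]
      refine mul_le_mul_of_nonneg_left ?_ (Real.log_natCast_nonneg _)
      rw [Nat.cast_pow, ← Real.rpow_natCast_mul hp0.le, Nat.cast_add,
        show ((((i n).2 : ℝ) + (2 : ℕ)) * -α) = -(2 * α) + -α * (i n).2 by push_cast; ring,
        Real.rpow_add hp0, Real.rpow_mul_natCast hp0.le]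
      refine mul_le_mul_of_nonneg_left (pow_le_pow_left₀ (by positivity) ?_ _) (by positivity)
      exact Real.rpow_le_rpow_of_nonpos two_pos hp2 (by linarith)
  · intro n hn
    have hn' : IsPrimePow n → n.Prime := by simpa [hs] using hn
    split_ifs with hp
    · simp
    · rw [vonMangoldt_apply, if_neg fun h => hp (hn' h), zero_mul]

theorem summable_vonMangoldt_mul_rpow {σ : ℝ} (hσ : 1 < σ) :
    Summable fun n : ℕ => vonMangoldt n * (n : ℝ) ^ (-σ) := by
  refine (summable_residueClass_mul_log_pow (q := 1) 0 0 hσ).congr fun n => ?_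
  simp [residueClass, Subsingleton.elim (n : ZMod 1) 0]

theorem tsum_residueClass_le {q : ℕ} {a : ZMod q} (k : ℕ) {A r α B Y : ℝ} (hr : 0 < r)
    (hα : 1 / 2 < α) (hrα : r + α = A + 1) (hB : 0 < B) (hBA : B + 1 ≤ A) (hY : 0 < Y)
    (hno : ∀ p : ℕ, p.Prime → (p : ZMod q) = a → Y < p) :
    ∑' n : ℕ, residueClass a n * (Real.log n ^ k * (n : ℝ) ^ (-(A + 1))) ≤
      k.factorial * ((∑' n : ℕ, (if n.Prime then 0 else vonMangoldt n) * (n : ℝ) ^ (-α)) / r ^ k +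
        (∑' n : ℕ, vonMangoldt n * (n : ℝ) ^ (-2 : ℝ)) * (Y ^ (-(A - 1 - B)) / B ^ k)) := by
  have h1 := (summable_nonprime hα).mul_left (k.factorial / r ^ k)
  have h2 := (summable_vonMangoldt_mul_rpow one_lt_two).mul_left
    (k.factorial / B ^ k * Y ^ (-(A - 1 - B)))
  have hle : ∀ n : ℕ, residueClass a n * (Real.log n ^ k * (n : ℝ) ^ (-(A + 1))) ≤
      k.factorial / r ^ k * ((if n.Prime then 0 else vonMangoldt n) * (n : ℝ) ^ (-α)) +
      k.factorial / B ^ k * Y ^ (-(A - 1 - B)) * (vonMangoldt n * (n : ℝ) ^ (-2 : ℝ)) := by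
    intro n
    have hΛ : 0 ≤ vonMangoldt n := vonMangoldt_nonneg
    have hN : 0 ≤ k.factorial / r ^ k * ((if n.Prime then 0 else vonMangoldt n) * (n : ℝ) ^ (-α)) := by
      split_ifs <;> positivity
    have hM : 0 ≤ k.factorial / B ^ k * Y ^ (-(A - 1 - B)) * (vonMangoldt n * (n : ℝ) ^ (-2 : ℝ)) := by
      positivity
    by_cases hn : (n : ZMod q) = a ∧ n ≠ 0
    · obtain ⟨hna, hn0⟩ := hn
      have hn' : (0 : ℝ) < n := by exact_mod_cast Nat.pos_of_ne_zero hn0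
      rw [residueClass, Set.indicator_of_mem (by simpa using hna)]
      by_cases hp : n.Prime
      · refine le_add_of_nonneg_of_le hN ?_
        rw [show -(A + 1) = -B + (-(A - 1 - B) + -2) by ring, Real.rpow_add hn',
          Real.rpow_add hn']
        have e1 := Real.log_pow_mul_rpow_neg_le k n hB
        have e2 := Real.rpow_le_rpow_of_nonpos hY (hno n hp hna).le
          (show -(A - 1 - B) ≤ 0 by linarith)
        calc vonMangoldt n * (Real.log n ^ k * ((n : ℝ) ^ (-B) * ((n : ℝ) ^ (-(A - 1 - B)) *
              (n : ℝ) ^ (-2 : ℝ))))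
            = (Real.log n ^ k * (n : ℝ) ^ (-B)) * (n : ℝ) ^ (-(A - 1 - B)) *
              (vonMangoldt n * (n : ℝ) ^ (-2 : ℝ)) := by ring
          _ ≤ _ := by gcongr
      · refine le_add_of_le_of_nonneg ?_ hM
        rw [if_neg hp, ← hrα, neg_add, Real.rpow_add hn']
        have e1 := Real.log_pow_mul_rpow_neg_le k n hr
        calc vonMangoldt n * (Real.log n ^ k * ((n : ℝ) ^ (-r) * (n : ℝ) ^ (-α)))
            = (Real.log n ^ k * (n : ℝ) ^ (-r)) * (vonMangoldt n * (n : ℝ) ^ (-α)) := by ring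
          _ ≤ _ := by gcongr
    · have h0 : residueClass a n = 0 := by
        by_cases hna : (n : ZMod q) = a
        · obtain rfl : n = 0 := by tauto
          simp
        · rw [residueClass, Set.indicator_of_notMem (by simpa using hna)]
      rw [h0, zero_mul]
      exact add_nonneg hN hM
  refine (Summable.tsum_le_tsum hle
    (summable_residueClass_mul_log_pow a k (by linarith)) (h1.add h2)).trans (le_of_eq ?_)
  rw [h1.tsum_add h2, tsum_mul_left, tsum_mul_left]
  ring

end ArithmeticFunction.vonMangoldt

theorem eventually_sq_mul_exp_add_exp_lt_one (K M : ℝ) {δ η : ℝ} (hδ : 0 < δ) (hη : 0 < η) :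
    ∀ᶠ x : ℝ in Filter.atTop, K * x ^ 2 * Real.exp (-δ * x) + M * Real.exp (-η * x) < 1 := by
  have h1 := (tendsto_rpow_mul_exp_neg_mul_atTop_nhds_zero 2 δ hδ).const_mul K
  have h2 := (tendsto_rpow_mul_exp_neg_mul_atTop_nhds_zero 0 η hη).const_mul M
  have h := h1.add h2
  simp only [mul_zero, add_zero, Real.rpow_zero, one_mul, Real.rpow_two, ← mul_assoc] at h
  exact h.eventually_lt_const one_pos

theorem one_lt_mul_log_one_add_div {θ A : ℝ} (h0 : 0 < θ) (h1 : θ ≤ 1 / 8) (hA : A * θ ^ 3 = 1) :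
    1 < (2 + 8 * θ) * A * Real.log ((A + 1 / 2 - θ) / A) := by
  have hA0 : 0 < A := by
    by_contra h
    nlinarith [pow_pos h0 3]
  have hAθ : 64 ≤ A * θ := by
    by_contra! h
    nlinarith [mul_pos h0 h0, mul_lt_mul_of_pos_right h (mul_pos h0 h0)]
  have hr : 0 < A + 1 / 2 - θ := by linarith
  have hlog := Real.one_sub_inv_le_log_of_pos (div_pos hr hA0)
  have he : 1 - ((A + 1 / 2 - θ) / A)⁻¹ = (1 / 2 - θ) / (A + 1 / 2 - θ) := by
    rw [inv_div, one_sub_div hr.ne']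
    ring
  rw [he] at hlog
  refine lt_of_lt_of_le ?_ (mul_le_mul_of_nonneg_left hlog (by positivity))
  rw [← mul_div_assoc, lt_div_iff₀ hr]
  nlinarith [mul_nonneg (mul_pos hA0 h0).le (sub_nonneg.2 h1)]

theorem one_add_mul_lt_mul_sub {θ A : ℝ} (h0 : 0 < θ) (h1 : θ ≤ 1 / 8) (hA : A * θ ^ 3 = 1) :
    1 + (2 + 8 * θ) * A * θ < (2 + 18 * θ) * (A - 1 - A / (1 + θ)) := by
  have hAθ : 8 ≤ A * θ ^ 2 := by
    by_contra! h
    nlinarith [mul_lt_mul_of_pos_right h h0]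
  have he : (2 + 18 * θ) * (A - 1 - A / (1 + θ)) =
      ((2 + 8 * θ) * A * θ * (1 + θ) + 8 * (1 - θ) * (A * θ ^ 2) -
        (2 + 18 * θ) * (1 + θ)) / (1 + θ) := by
    field_simp
    ring
  rw [he, lt_div_iff₀ (by positivity)]
  nlinarith

theorem inv_pow_le_exp {x c L : ℝ} {k : ℕ} (hx : 1 ≤ x) (hk : c * L ≤ k) :
    x⁻¹ ^ k ≤ Real.exp (-(c * Real.log x) * L) := by
  have hx0 : 0 < x := one_pos.trans_le hx
  rw [← Real.rpow_natCast, Real.rpow_def_of_pos (inv_pos.2 hx0), Real.exp_le_exp, Real.log_inv]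
  linarith [mul_le_mul_of_nonneg_left hk (Real.log_nonneg hx)]

theorem one_add_pow_le_exp {θ x : ℝ} {k : ℕ} (hθ : 0 ≤ θ) (hx : 0 ≤ x) (hk : k ≤ x + 1) :
    (1 + θ) ^ k ≤ (1 + θ) * Real.exp (θ * x) := by
  have hl : Real.log (1 + θ) ≤ θ := by
    have := Real.log_le_sub_one_of_pos (show 0 < 1 + θ by linarith)
    linarith
  have hl0 : 0 ≤ Real.log (1 + θ) := Real.log_nonneg (by linarith)
  rw [← Real.rpow_natCast, Real.rpow_def_of_pos (by positivity)]
  calc Real.exp (Real.log (1 + θ) * k)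
      ≤ Real.exp (Real.log (1 + θ) + θ * x) := by
        rw [Real.exp_le_exp]
        linarith [mul_le_mul_of_nonneg_left hk hl0, mul_le_mul_of_nonneg_right hl hx]
    _ = _ := by rw [Real.exp_add, Real.exp_log (by linarith)]

theorem add_mul_le_mul_sq {C D G c k L : ℝ} (hC : 0 ≤ C) (hD : 0 ≤ D) (hG : 0 ≤ G) (hc : 0 ≤ c)
    (hL : 1 ≤ L) (hk : k ≤ c * L + 1) :
    C + D * (k + 1) * (G + L) ≤ (C + D * (c + 2) * (G + 1)) * L ^ 2 := by
  have e1 : k + 1 ≤ (c + 2) * L := by linarith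
  have e2 : G + L ≤ (G + 1) * L := by linarith [le_mul_of_one_le_right hG hL]
  have e3 : C ≤ C * L ^ 2 := le_mul_of_one_le_right hC (one_le_pow₀ hL)
  calc C + D * (k + 1) * (G + L)
      ≤ C * L ^ 2 + D * ((c + 2) * L) * ((G + 1) * L) := by gcongr
    _ = _ := by ring

/-- Under GRH, every reduced residue class modulo a large `q` contains a prime of size at most
`q ^ (2 + o(1))`. -/
theorem eventually_exists_prime_le_rpow (hGRH : GRH) {θ : ℝ} (h0 : 0 < θ) (h1 : θ ≤ 1 / 8) :
    ∀ᶠ q : ℕ in Filter.atTop, ∀ a : ZMod q, IsUnit a →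
      ∃ p : ℕ, p.Prime ∧ (p : ZMod q) = a ∧ (p : ℝ) ≤ (q : ℝ) ^ (2 + 18 * θ) := by
  obtain ⟨A, hA⟩ : ∃ A : ℝ, A * θ ^ 3 = 1 := ⟨(θ ^ 3)⁻¹, inv_mul_cancel₀ (by positivity)⟩
  have hA0 : 0 < A := by
    by_contra h
    nlinarith [pow_pos h0 3]
  have hδ := one_lt_mul_log_one_add_div h0 h1 hA
  have hη := one_add_mul_lt_mul_sub h0 h1 hA
  have hA1 : 1 ≤ A := by
    have : θ ^ 3 ≤ 1 := pow_le_one₀ h0.le (by linarith)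
    nlinarith
  set r := A + 1 / 2 - θ with hr
  set B := A / (1 + θ) with hB
  set c := (2 + 8 * θ) * A with hc
  have hr1 : 1 ≤ r := by rw [hr]; linarith
  have hr0 : 0 < r := by linarith
  have hB0 : 0 < B := by positivity
  have hc0 : 0 < c := by positivity
  have hBA : B + 1 ≤ A := by
    have : 0 < (2 + 18 * θ) * (A - 1 - B) := lt_trans (by positivity) hη
    have := pos_of_mul_pos_right this (by positivity)
    linarith
  obtain ⟨C, D, hC, hD, hbound⟩ :=
    DirichletCharacter.exists_norm_iteratedDeriv_logDeriv_le hGRH (A := A) (r := r) hA1 hr1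
      (by rw [hr]; linarith)
  set C₁ := ∑' n : ℕ, (if n.Prime then 0 else ArithmeticFunction.vonMangoldt n) *
    (n : ℝ) ^ (-(1 / 2 + θ)) with hC₁
  set C₂ := ∑' n : ℕ, ArithmeticFunction.vonMangoldt n * (n : ℝ) ^ (-2 : ℝ) with hC₂
  have hC₁0 : 0 ≤ C₁ := tsum_nonneg fun n => mul_nonneg
    (by split_ifs; exacts [le_rfl, ArithmeticFunction.vonMangoldt_nonneg]) (by positivity)
  have hC₂0 : 0 ≤ C₂ := tsum_nonneg fun n => mul_nonneg
    ArithmeticFunction.vonMangoldt_nonneg (by positivity)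
  have hlogC : 0 < Real.log C := Real.log_pos hC
  set K := C₁ + D * (c + 2) * (Real.log C + 1) with hK
  filter_upwards [(Real.tendsto_log_atTop.comp tendsto_natCast_atTop_atTop).eventually
      (eventually_sq_mul_exp_add_exp_lt_one (A * K) (A * C₂ * (1 + θ)) (sub_pos.2 hδ) (sub_pos.2 hη)),
    (Real.tendsto_log_atTop.comp tendsto_natCast_atTop_atTop).eventually_ge_atTop (1 : ℝ),
    Filter.eventually_gt_atTop 0] with q hq hL hq0 a ha
  by_contra! hno
  have : NeZero q := ⟨hq0.ne'⟩
  have hq0' : (0 : ℝ) < q := by exact_mod_cast hq0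
  simp only [Function.comp_apply] at hq hL
  set L := Real.log q with hLdef
  have hqL : (q : ℝ) = Real.exp L := (Real.exp_log hq0').symm
  set k := ⌈c * L⌉₊ with hk
  have hk1 : c * L ≤ k := Nat.le_ceil _
  have hk2 : (k : ℝ) ≤ c * L + 1 := (Nat.ceil_lt_add_one (by positivity)).le
  have hmain := ArithmeticFunction.vonMangoldt.factorial_div_pow_le hGRH ha k hA0
    (hbound q · k)
  have hS := ArithmeticFunction.vonMangoldt.tsum_residueClass_le (a := a) k (A := A) hr0
    (α := 1 / 2 + θ) (by linarith) (by rw [hr]; ring) hB0 hBA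
    (show 0 < (q : ℝ) ^ (2 + 18 * θ) by positivity) hno
  rw [← hC₁, ← hC₂] at hS
  have hlogCq : Real.log (C * q) = Real.log C + L := Real.log_mul (by positivity) hq0'.ne'
  have hY : ((q : ℝ) ^ (2 + 18 * θ)) ^ (-(A - 1 - B)) =
      Real.exp (-((2 + 18 * θ) * (A - 1 - B)) * L) := by
    rw [← Real.rpow_mul hq0'.le, Real.rpow_def_of_pos hq0', ← hLdef]
    ring_nf
  rw [hY] at hS
  rw [hlogCq] at hmain
  set Z := Real.exp (-((2 + 18 * θ) * (A - 1 - B)) * L) with hZ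
  have hkfac : (0 : ℝ) < k.factorial := by exact_mod_cast k.factorial_pos
  have hone : 1 ≤ q * A * ((C₁ + D * (k + 1) * (Real.log C + L)) * (A / r) ^ k +
      C₂ * ((A / B) ^ k * Z)) := by
    have h2 := hmain.trans (mul_le_mul_of_nonneg_left (add_le_add_left hS _) hq0'.le)
    rw [div_le_iff₀ (by positivity)] at h2
    refine le_of_mul_le_mul_left ?_ hkfac
    rw [mul_one]
    refine h2.trans (le_of_eq ?_)
    rw [div_pow, div_pow, pow_succ]
    ring
  have hAr : (A / r) ^ k ≤ Real.exp (-(c * Real.log (r / A)) * L) := by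
    rw [← inv_div r A]
    exact inv_pow_le_exp ((one_le_div hA0).2 (by rw [hr]; linarith)) hk1
  have hAB : (A / B) ^ k ≤ (1 + θ) * Real.exp (θ * (c * L)) := by
    rw [hB, div_div_cancel₀ hA0.ne']
    exact one_add_pow_le_exp h0.le (by positivity) hk2
  have hKL : C₁ + D * (k + 1) * (Real.log C + L) ≤ K * L ^ 2 :=
    add_mul_le_mul_sq hC₁0 hD hlogC.le hc0.le hL hk2
  have hK0 : 0 ≤ K := by positivity
  refine absurd hq (not_lt.2 (hone.trans ?_))
  calc q * A * ((C₁ + D * (k + 1) * (Real.log C + L)) * (A / r) ^ k + C₂ * ((A / B) ^ k * Z))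
      ≤ q * A * (K * L ^ 2 * Real.exp (-(c * Real.log (r / A)) * L) +
          C₂ * ((1 + θ) * Real.exp (θ * (c * L)) * Z)) := by gcongr
    _ = A * K * L ^ 2 * (Real.exp L * Real.exp (-(c * Real.log (r / A)) * L)) +
          A * C₂ * (1 + θ) * (Real.exp L * Real.exp (θ * (c * L)) * Z) := by rw [hqL]; ring
    _ = _ := by
        rw [hZ, ← Real.exp_add, ← Real.exp_add, ← Real.exp_add]
        ring_nf

theorem Nat.exists_coprime_modEq_neg_two_modEq_two {u v : ℕ} (hu : Odd u) (hv : Odd v)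
    (hu2 : 2 ≤ u) (huv : u.Coprime v) :
    ∃ a : ℕ, a.Coprime (u * v) ∧ a + 2 ≡ 0 [MOD u] ∧ a ≡ 2 [MOD v] := by
  obtain ⟨a, hau, hav⟩ := Nat.chineseRemainder huv (u - 2) 2
  refine ⟨a, Nat.Coprime.mul_right ?_ ?_, ?_, hav⟩
  · rw [Nat.Coprime, hau.gcd_eq, ← Nat.Coprime, Nat.coprime_self_sub_left hu2]
    exact Nat.coprime_two_left.2 hu
  · rw [Nat.Coprime, hav.gcd_eq]
    exact Nat.coprime_two_left.2 hv
  · have := hau.add_right 2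
    rw [Nat.sub_add_cancel hu2] at this
    exact this.trans (by simp [Nat.ModEq])

theorem eventually_rpow_lt_sub_two {ρ : ℝ} (hρ : ρ < 1) :
    ∀ᶠ x : ℝ in Filter.atTop, x ^ ρ < x - 2 := by
  filter_upwards [(tendsto_rpow_atTop (sub_pos.2 hρ)).eventually_ge_atTop 4,
    Filter.eventually_ge_atTop 3] with x hx hx3
  have hx0 : 0 < x := by linarith
  have h : x ^ ρ * x ^ (1 - ρ) = x := by rw [← Real.rpow_add hx0]; simp
  nlinarith [Real.rpow_pos_of_pos hx0 ρ]

/-- Under GRH, for every `0 < ε < 1/8` there are infinitely many primes `p` such that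
`p + 2` has a square factor `m²` with `m > p^ε` and `p - 2` has a square factor `n²`
with `n > p^ε`. -/
theorem infinitely_many_primes_with_large_square_factors_GRH (hGRH : GRH)
    (ε : ℝ) (hε : 0 < ε) (hε' : ε < 1 / 8) :
    {p : ℕ | p.Prime ∧ ∃ m n : ℕ, 0 < m ∧ 0 < n ∧
      (m : ℤ) ^ 2 ∣ (p : ℤ) + 2 ∧ (n : ℤ) ^ 2 ∣ (p : ℤ) - 2 ∧
      (p : ℝ) ^ ε < m ∧ (p : ℝ) ^ ε < n}.Infinite := by
  refine Set.infinite_of_forall_exists_gt fun N => ?_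
  obtain ⟨θ, hθ0, hθ1, hθε⟩ : ∃ θ : ℝ, 0 < θ ∧ θ ≤ 1 / 8 ∧ (8 + 72 * θ) * ε < 1 :=
    ⟨(1 - 8 * ε) / 9, by linarith, by linarith, by nlinarith⟩
  have hodd : Filter.Tendsto (fun t : ℕ => 2 * t + 3) Filter.atTop Filter.atTop :=
    Filter.tendsto_atTop_mono (fun t => show t ≤ 2 * t + 3 by omega) Filter.tendsto_id
  have hmod : Filter.Tendsto (fun t : ℕ => (2 * t + 1) ^ 2 * (2 * t + 3) ^ 2)
      Filter.atTop Filter.atTop :=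
    Filter.tendsto_atTop_mono (fun t => by nlinarith) hodd
  obtain ⟨t, hprime, hlt, ht⟩ := ((hmod.eventually
    (eventually_exists_prime_le_rpow hGRH hθ0 hθ1)).and
    (((tendsto_natCast_atTop_atTop.comp hodd).eventually (eventually_rpow_lt_sub_two hθε)).and
    (Filter.eventually_ge_atTop (N + 1)))).exists
  have hcop : (2 * t + 1).Coprime (2 * t + 3) := by
    rw [show 2 * t + 3 = 2 * t + 1 + 2 by ring, Nat.coprime_self_add_right]
    exact Nat.coprime_two_right.2 (odd_two_mul_add_one t)
  obtain ⟨a, haq, ham, han⟩ := Nat.exists_coprime_modEq_neg_two_modEq_two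
    (odd_two_mul_add_one t).pow (show Odd (2 * t + 3) from ⟨t + 1, by ring⟩).pow
    (by nlinarith : 2 ≤ (2 * t + 1) ^ 2) (hcop.pow 2 2)
  obtain ⟨p, hp, hpa, hple⟩ := hprime a ((ZMod.isUnit_iff_coprime _ _).2 haq)
  rw [ZMod.natCast_eq_natCast_iff] at hpa
  have hdvd : (2 * t + 1) ^ 2 ∣ p + 2 :=
    (Nat.modEq_zero_iff_dvd).1 (((hpa.of_mul_right _).add_right 2).trans ham)
  have hdvd' : (((2 * t + 3) ^ 2 : ℕ) : ℤ) ∣ (p : ℤ) - (2 : ℕ) :=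
    Nat.modEq_iff_dvd.1 ((hpa.of_mul_left _).trans han).symm
  have hsize : (p : ℝ) ^ ε < 2 * t + 1 := by
    have hq : (((2 * t + 1) ^ 2 * (2 * t + 3) ^ 2 : ℕ) : ℝ) ≤ (2 * (t : ℝ) + 3) ^ (4 : ℝ) := by
      rw [show (4 : ℝ) = (4 : ℕ) by norm_num, Real.rpow_natCast]
      push_cast
      calc (2 * (t : ℝ) + 1) ^ 2 * (2 * t + 3) ^ 2
          ≤ (2 * (t : ℝ) + 3) ^ 2 * (2 * t + 3) ^ 2 := by gcongr; norm_num
        _ = _ := by ring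
    have h3 : (2 * (t : ℝ) + 3) ^ ((8 + 72 * θ) * ε) < 2 * t + 1 := by
      have := hlt
      simp only [Function.comp_apply] at this
      push_cast at this
      linarith
    refine lt_of_le_of_lt ?_ h3
    calc (p : ℝ) ^ ε ≤ (((2 * (t : ℝ) + 3) ^ (4 : ℝ)) ^ (2 + 18 * θ)) ^ ε := by
          refine Real.rpow_le_rpow p.cast_nonneg (hple.trans ?_) hε.le
          exact Real.rpow_le_rpow (Nat.cast_nonneg _) hq (by positivity)
      _ = (2 * (t : ℝ) + 3) ^ ((8 + 72 * θ) * ε) := by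
          rw [← Real.rpow_mul (by positivity), ← Real.rpow_mul (by positivity)]
          ring_nf
  refine ⟨p, ⟨hp, 2 * t + 1, 2 * t + 3, by omega, by omega, by exact_mod_cast hdvd,
    by exact_mod_cast hdvd', by exact_mod_cast hsize, ?_⟩, ?_⟩
  · push_cast
    linarith
  · have := Nat.le_of_dvd (by omega) hdvd
    nlinarith
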